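/- arXiv:2509.23669 — 9 statements merged into one kernel-verified Lean document; each statement's English description precedes it below -/
import Mathlib

section
/- If φ_1,…,φ_k are comparison functions, then φ := max{φ_1,…,φ_k} (pointwise maximum) is a comparison function. -/
open Filter Topology Set

/-- A comparison function: a selfmap of `[0,∞)` (modelled as a map `ℝ → ℝ` preserving
`[0,∞)`) which is nondecreasing on `[0,∞)` and whose sequence of iterates at every
`t ≥ 0` converges to `0`. -/
def IsComparisonFn (φ : ℝ → ℝ) : Prop :=
  (∀ t : ℝ, 0 ≤ t → 0 ≤ φ t) ∧ MonotoneOn φ (Set.Ici 0) ∧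
    ∀ t : ℝ, 0 ≤ t → Tendsto (fun n : ℕ => φ^[n] t) atTop (nhds 0)

theorem comparison_no_inv {f : ℝ → ℝ} (hf : IsComparisonFn f) (P : ℝ → Prop) (c x : ℝ)
    (hc : 0 < c) (hP : ∀ s, P s → P (f s)) (hPc : ∀ s, P s → c ≤ s) (hx : P x) : False := by
  have h1 : ∀ n : ℕ, P (f^[n] x) := by
    intro n
    induction n with
    | zero => exact hx
    | succ n ih => rw [Function.iterate_succ_apply']; exact hP _ ih
  have h2 := ge_of_tendsto' (hf.2.2 x (hc.le.trans (hPc x hx))) (fun n => hPc _ (h1 n))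
  linarith

theorem comparison_lt {f : ℝ → ℝ} (hf : IsComparisonFn f) (t : ℝ) (ht : 0 < t) : f t < t := by
  by_contra! h
  refine comparison_no_inv hf (fun s => t ≤ s) t t ht (fun s hs => ?_) (fun s hs => hs) le_rfl
  exact h.trans (hf.2.1 ht.le (ht.le.trans hs) hs)

theorem comparison_le {f : ℝ → ℝ} (hf : IsComparisonFn f) (t : ℝ) (ht : 0 ≤ t) : f t ≤ t := by
  by_contra! h
  refine comparison_no_inv hf (fun s => f t ≤ s) (f t) (f t) (ht.trans_lt h) (fun s hs => ?_)
    (fun s hs => hs) le_rfl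
  exact hf.2.1 ht (ht.trans (h.le.trans hs)) (h.le.trans hs)

/-- If `φ 1, …, φ k` are comparison functions, then their pointwise maximum is a
comparison function. -/
theorem max_comparison (k : ℕ) (hk : 0 < k) (φ : Fin k → ℝ → ℝ)
    (hφ : ∀ i, IsComparisonFn (φ i)) :
    IsComparisonFn (fun t => ⨆ i, φ i t) := by
  haveI : Nonempty (Fin k) := ⟨⟨0, hk⟩⟩
  have bdd : ∀ t, BddAbove (Set.range fun i => φ i t) := fun t => (Set.finite_range _).bddAbove
  set F : ℝ → ℝ := fun t => ⨆ i, φ i t with hF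
  have attained : ∀ t, ∃ i, φ i t = F t := fun t => exists_eq_ciSup_of_finite
  have h0 : ∀ t : ℝ, 0 ≤ t → 0 ≤ F t := by
    intro t ht
    obtain ⟨i, hi⟩ := attained t
    rw [← hi]; exact (hφ i).1 t ht
  have hmono : MonotoneOn F (Set.Ici 0) := by
    intro a ha b hb hab
    obtain ⟨i, hi⟩ := attained a
    rw [← hi]
    exact ((hφ i).2.1 ha hb hab).trans (le_ciSup (bdd b) i)
  refine ⟨h0, hmono, fun t ht => ?_⟩
  have hn : ∀ n : ℕ, 0 ≤ F^[n] t := by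
    intro n
    induction n with
    | zero => exact ht
    | succ n ih => rw [Function.iterate_succ_apply']; exact h0 _ ih
  have hle : ∀ s, 0 ≤ s → F s ≤ s := fun s hs => ciSup_le fun i => comparison_le (hφ i) s hs
  have hanti : Antitone (fun n : ℕ => F^[n] t) := by
    refine antitone_nat_of_succ_le fun n => ?_
    rw [Function.iterate_succ_apply']
    exact hle _ (hn n)
  have hbb : BddBelow (Set.range fun n : ℕ => F^[n] t) := ⟨0, by rintro _ ⟨n, rfl⟩; exact hn n⟩
  have hlim := tendsto_atTop_ciInf hanti hbb
  have hLle : ∀ n : ℕ, (⨅ n : ℕ, F^[n] t) ≤ F^[n] t := fun n => ciInf_le hbb n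
  have hL0 : 0 ≤ ⨅ n : ℕ, F^[n] t := le_ciInf hn
  generalize (⨅ n : ℕ, F^[n] t) = L at hlim hLle hL0
  rcases hL0.eq_or_lt with h | hL
  · rw [h]; exact hlim
  exfalso
  have hs : ∀ i, ∃ s, L < s ∧ φ i s ≤ L := by
    intro i
    by_contra! h
    exact comparison_no_inv (hφ i) (fun s => L < s) L (L + 1) hL h (fun s hs => hs.le) (by linarith)
  choose s hs1 hs2 using hs
  obtain ⟨j, hj⟩ := Finite.exists_min s
  obtain ⟨n, hns⟩ := (hlim.eventually (gt_mem_nhds (hs1 j))).exists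
  have hFL : F (F^[n] t) ≤ L := ciSup_le fun i =>
    ((hφ i).2.1 (hn n) (hL.le.trans (hs1 i).le) (hns.le.trans (hj i))).trans (hs2 i)
  have h3 := hLle (n + 2)
  rw [Function.iterate_succ_apply', Function.iterate_succ_apply'] at h3
  have h4 := hmono (h0 _ (hn n)) hL.le hFL
  obtain ⟨i, hi⟩ := attained L
  have h5 := comparison_lt (hφ i) L hL
  linarith
end

section
/- Let d_1,…,d_n be pseudometrics on a set X and let f:X→X be a Matkowski contraction with respect to each d_j with witness φ_j. Then f is a Matkowski contraction with respect to the pseudometric d := max{d_1,…,d_n} (pointwise maximum) with witness φ := max{φ_1,…,φ_n}; in particular d(f(x),f(y)) ≤ φ(d(x,y)) for all x,y ∈ X and φ is a comparison function. -/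
open Filter Topology Set

/-- A pseudometric on `X`: a nonnegative, symmetric map vanishing on the diagonal and
satisfying the triangle inequality. -/
def IsPseudometricFn {X : Type*} (d : X → X → ℝ) : Prop :=
  (∀ x y, 0 ≤ d x y) ∧ (∀ x, d x x = 0) ∧ (∀ x y, d x y = d y x) ∧
    ∀ x y z, d x y ≤ d x z + d z y

theorem cmp_inv {φ : ℝ → ℝ} (h : IsComparisonFn φ) (P : ℝ → Prop) (c t : ℝ) (ht : 0 ≤ t)
    (hP : P t) (hs : ∀ s, P s → P (φ s)) (hc : ∀ s, P s → c ≤ s) : c ≤ 0 := by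
  have key : ∀ k : ℕ, P (φ^[k] t) := by
    intro k
    induction k with
    | zero => simpa using hP
    | succ k ih => rw [Function.iterate_succ_apply']; exact hs _ ih
  exact ge_of_tendsto' (h.2.2 t ht) (fun k => hc _ (key k))

theorem cmp_lt {φ : ℝ → ℝ} (h : IsComparisonFn φ) {t : ℝ} (ht : 0 < t) : φ t < t := by
  by_contra hcon
  push Not at hcon
  have := cmp_inv h (fun s => t ≤ s) t t ht.le le_rfl
    (fun s hs => hcon.trans (h.2.1 (mem_Ici.2 ht.le) (mem_Ici.2 (ht.le.trans hs)) hs))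
    (fun s hs => hs)
  linarith

theorem cmp_zero {φ : ℝ → ℝ} (h : IsComparisonFn φ) : φ 0 = 0 := by
  have h0 := h.1 0 le_rfl
  refine le_antisymm ?_ h0
  refine cmp_inv h (fun s => φ 0 ≤ s) (φ 0) (φ 0) h0 le_rfl
    (fun s hs => h.2.1 (mem_Ici.2 le_rfl) (mem_Ici.2 (h0.trans hs)) (h0.trans hs))
    (fun s hs => hs)

theorem cmp_right {φ : ℝ → ℝ} (h : IsComparisonFn φ) {L : ℝ} (hL : 0 < L) :
    ∃ s, L < s ∧ φ s ≤ L := by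
  by_contra hcon
  push Not at hcon
  have := cmp_inv h (fun s => L < s) L (L + 1) (by linarith) (by linarith)
    (fun s hs => hcon s hs) (fun s hs => hs.le)
  linarith

theorem cmp_max (n : ℕ) (hn : 0 < n) (φ : Fin n → ℝ → ℝ)
    (hφ : ∀ j, IsComparisonFn (φ j)) : IsComparisonFn (fun t => ⨆ j, φ j t) := by
  haveI : Nonempty (Fin n) := ⟨⟨0, hn⟩⟩
  have bdd : ∀ g : Fin n → ℝ, BddAbove (range g) := fun g => (finite_range g).bddAbove
  set Φ : ℝ → ℝ := fun t => ⨆ j, φ j t with hΦ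
  have nonneg : ∀ t : ℝ, 0 ≤ t → 0 ≤ Φ t := fun t ht =>
    Real.iSup_nonneg (fun j => (hφ j).1 t ht)
  have mono : MonotoneOn Φ (Ici 0) := fun a ha b hb hab =>
    ciSup_mono (bdd _) (fun j => (hφ j).2.1 ha hb hab)
  have lt : ∀ t, 0 < t → Φ t < t := by
    intro t ht
    obtain ⟨j, hj⟩ := exists_eq_ciSup_of_finite (f := fun j => φ j t)
    have := cmp_lt (hφ j) ht
    simp only [hΦ]
    rw [← hj]
    exact this
  have le : ∀ t, 0 ≤ t → Φ t ≤ t := by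
    intro t ht
    rcases ht.eq_or_lt with rfl | ht
    · exact ciSup_le (fun j => (cmp_zero (hφ j)).le)
    · exact (lt t ht).le
  refine ⟨nonneg, mono, ?_⟩
  intro t ht
  have a0 : ∀ k : ℕ, 0 ≤ Φ^[k] t := by
    intro k
    induction k with
    | zero => simpa using ht
    | succ k ih => rw [Function.iterate_succ_apply']; exact nonneg _ ih
  have anti : Antitone (fun k : ℕ => Φ^[k] t) := by
    refine antitone_nat_of_succ_le (fun k => ?_)
    rw [Function.iterate_succ_apply']
    exact le _ (a0 k)
  have hbb : BddBelow (range (fun k : ℕ => Φ^[k] t)) := ⟨0, by rintro _ ⟨k, rfl⟩; exact a0 k⟩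
  have lim := tendsto_atTop_ciInf anti hbb
  have hLle : ∀ k : ℕ, (⨅ k : ℕ, Φ^[k] t) ≤ Φ^[k] t := fun k => ciInf_le hbb k
  have hL0 : 0 ≤ ⨅ k : ℕ, Φ^[k] t := le_ciInf a0
  generalize (⨅ k : ℕ, Φ^[k] t) = L at lim hLle hL0
  rcases hL0.eq_or_lt with h | hL
  · rw [h]; exact lim
  exfalso
  choose s hs1 hs2 using fun j => cmp_right (hφ j) hL
  have ev : ∀ᶠ k : ℕ in atTop, ∀ j, Φ^[k] t < s j :=
    eventually_all.2 (fun j => lim.eventually (gt_mem_nhds (hs1 j)))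
  obtain ⟨k, hk⟩ := ev.exists
  have h1 : Φ^[k+1] t ≤ L := by
    rw [Function.iterate_succ_apply']
    refine ciSup_le (fun j => le_trans ?_ (hs2 j))
    exact (hφ j).2.1 (mem_Ici.2 (a0 k)) (mem_Ici.2 (hL.trans (hs1 j)).le) (hk j).le
  have h2 := hLle (k+1)
  have h3 := hLle (k+1+1)
  rw [Function.iterate_succ_apply'] at h3
  have h4 := lt _ (hL.trans_le h2)
  linarith

/-- If `f` is a Matkowski contraction w.r.t. each pseudometric `d j` with witness `φ j`,
then it is a Matkowski contraction w.r.t. the pointwise maximum of the `d j` with witness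
the pointwise maximum of the `φ j`: the maximum is again a pseudometric, the maximal
witness is a comparison function, and the contraction inequality holds. -/
theorem matkowski_max (X : Type*) (n : ℕ) (hn : 0 < n) (d : Fin n → X → X → ℝ)
    (hd : ∀ j, IsPseudometricFn (d j)) (f : X → X) (φ : Fin n → ℝ → ℝ)
    (hφ : ∀ j, IsComparisonFn (φ j))
    (hM : ∀ j, ∀ x y : X, d j (f x) (f y) ≤ φ j (d j x y)) :
    IsPseudometricFn (fun x y : X => ⨆ j, d j x y) ∧
    IsComparisonFn (fun t => ⨆ j, φ j t) ∧
    ∀ x y : X, (⨆ j, d j (f x) (f y)) ≤ (fun t => ⨆ j, φ j t) (⨆ j, d j x y) := by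
  haveI : Nonempty (Fin n) := ⟨⟨0, hn⟩⟩
  have bdd : ∀ g : Fin n → ℝ, BddAbove (range g) := fun g => (finite_range g).bddAbove
  have nn : ∀ x y, 0 ≤ ⨆ j, d j x y := fun x y => Real.iSup_nonneg (fun j => (hd j).1 x y)
  refine ⟨⟨nn, ?_, ?_, ?_⟩, cmp_max n hn φ hφ, ?_⟩
  · intro x
    simp [(hd _).2.1 x]
  · intro x y
    exact iSup_congr (fun j => (hd j).2.2.1 x y)
  · intro x y z
    exact ciSup_le (fun j => ((hd j).2.2.2 x y z).trans
      (add_le_add (le_ciSup (bdd fun j => d j x z) j) (le_ciSup (bdd fun j => d j z y) j)))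
  · intro x y
    refine ciSup_mono (bdd _) (fun j => (hM j x y).trans ?_)
    exact (hφ j).2.1 (mem_Ici.2 ((hd j).1 x y)) (mem_Ici.2 (nn x y))
      (le_ciSup (bdd fun j => d j x y) j)
end

section
/- Let X be a Hausdorff topological space, u ∈ K_F(X), and ρ:[0,1]→[0,1] nondecreasing, right continuous with ρ(0)=0. Then: (a) for every α ∈ (0,1] with α > ρ(1), the α-cut [ρ∘u]^α is empty; (b) for every α ∈ (0,1] with α ≤ ρ(1), setting β(α) := inf{t ∈ [0,1] : ρ(t) ≥ α}, if β(α) > 0 then [ρ∘u]^α = [u]^{β(α)}. -/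
open Filter Topology Set

/-- `u` belongs to `K_F(X)`: it is `[0,1]`-valued, normal, upper semicontinuous and has
compact support. -/
def IsFuzzyCompact {X : Type*} [TopologicalSpace X] (u : X → ℝ) : Prop :=
  (∀ x, u x ∈ Set.Icc (0 : ℝ) 1) ∧ (∃ x, u x = 1) ∧ UpperSemicontinuous u ∧
    IsCompact (closure {x | 0 < u x})

/-- A grey level map: a selfmap of `[0,1]` (modelled as a map `ℝ → ℝ` preserving `[0,1]`)
which is nondecreasing on `[0,1]`, right continuous there, and sends `0` to `0`. -/
def IsGreyMap (ρ : ℝ → ℝ) : Prop :=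
  (∀ t ∈ Set.Icc (0 : ℝ) 1, ρ t ∈ Set.Icc (0 : ℝ) 1) ∧ MonotoneOn ρ (Set.Icc 0 1) ∧
    ρ 0 = 0 ∧ ∀ t ∈ Set.Ico (0 : ℝ) 1, ContinuousWithinAt ρ (Set.Icc t 1) t

/-- Description of the positive `α`-cuts of `ρ ∘ u`: they are empty when `α > ρ(1)`, and
equal to the `β(α)`-cut of `u` when `α ≤ ρ(1)` and `β(α) > 0`, where
`β(α) = inf {t ∈ [0,1] : ρ(t) ≥ α}`. -/
theorem cuts_of_grey_composition {X : Type*} [TopologicalSpace X] [T2Space X]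
    (u : X → ℝ) (hu : IsFuzzyCompact u) (ρ : ℝ → ℝ) (hρ : IsGreyMap ρ) :
    (∀ α ∈ Set.Ioc (0 : ℝ) 1, ρ 1 < α → {x | α ≤ ρ (u x)} = ∅) ∧
    (∀ α ∈ Set.Ioc (0 : ℝ) 1, α ≤ ρ 1 →
      0 < sInf {t | t ∈ Set.Icc (0 : ℝ) 1 ∧ α ≤ ρ t} →
      {x | α ≤ ρ (u x)} = {x | sInf {t | t ∈ Set.Icc (0 : ℝ) 1 ∧ α ≤ ρ t} ≤ u x}) := by
  obtain ⟨hu01, -, -, -⟩ := hu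
  obtain ⟨-, hmono, -, hrc⟩ := hρ
  have h1 : (1 : ℝ) ∈ Set.Icc (0 : ℝ) 1 := ⟨zero_le_one, le_rfl⟩
  refine ⟨?_, ?_⟩
  · intro α _ hα
    ext x
    simp only [Set.mem_setOf_eq, Set.mem_empty_iff_false, iff_false, not_le]
    exact lt_of_le_of_lt (hmono (hu01 x) h1 (hu01 x).2) hα
  · intro α _ hα1 hpos
    set S : Set ℝ := {t | t ∈ Set.Icc (0 : ℝ) 1 ∧ α ≤ ρ t} with hS
    have hbdd : BddBelow S := ⟨0, fun t ht => ht.1.1⟩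
    have h1S : (1 : ℝ) ∈ S := ⟨h1, hα1⟩
    have hb1 : sInf S ≤ 1 := csInf_le hbdd h1S
    have hbI : sInf S ∈ Set.Icc (0 : ℝ) 1 := ⟨hpos.le, hb1⟩
    have key : α ≤ ρ (sInf S) := by
      rcases hb1.eq_or_lt with h | h
      · rw [h]; exact hα1
      · by_contra hlt
        push Not at hlt
        have hev := (hrc _ ⟨hpos.le, h⟩).eventually (gt_mem_nhds hlt)
        rw [eventually_nhdsWithin_iff, Metric.eventually_nhds_iff] at hev
        obtain ⟨ε, hε, hball⟩ := hev
        obtain ⟨t, htS, ht⟩ := exists_lt_of_csInf_lt ⟨1, h1S⟩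
          (show sInf S < sInf S + ε by linarith)
        have hle : sInf S ≤ t := csInf_le hbdd htS
        have := hball (y := t) (by rw [Real.dist_eq, abs_lt]; constructor <;> linarith)
          ⟨hle, htS.1.2⟩
        exact absurd htS.2 (not_le.mpr this)
    ext x
    simp only [Set.mem_setOf_eq]
    constructor
    · intro hx
      exact csInf_le hbdd ⟨hu01 x, hx⟩
    · intro hx
      exact key.trans (hmono hbI (hu01 x) hx)
end

section
/- Let X be a Hausdorff topological space, f:X→X continuous, u ∈ K_F(X), and ρ:[0,1]→[0,1] nondecreasing, right continuous with ρ(0)=0. Then [ρ∘(f[u])]^α = f([ρ∘u]^α) for every α ∈ (0,1], and moreover the supports agree: closure of {y : ρ(f[u](y)) > 0} equals f(closure of {x : ρ(u(x)) > 0}). -/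
open Filter Topology Set

open Classical in
/-- The Zadeh image of a fuzzy set `u` under `f`. -/
noncomputable def zadeh {X : Type*} (f : X → X) (u : X → ℝ) (y : X) : ℝ :=
  if (f ⁻¹' {y}).Nonempty then sSup (u '' (f ⁻¹' {y})) else 0

lemma zadeh_attained {X : Type*} [TopologicalSpace X] [T2Space X]
    (f : X → X) (hf : Continuous f) (u : X → ℝ) (hu : IsFuzzyCompact u) (x₁ : X) :
    ∃ x, f x = f x₁ ∧ zadeh f u (f x₁) = u x ∧ ∀ z, f z = f x₁ → u z ≤ u x := by
  obtain ⟨h01, -, husc, hc⟩ := hu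
  have key : ∃ x, f x = f x₁ ∧ ∀ z, f z = f x₁ → u z ≤ u x := by
    have hK : IsCompact (closure {x | 0 < u x} ∩ f ⁻¹' {f x₁}) :=
      hc.inter_right (isClosed_singleton.preimage hf)
    by_cases hne : (closure {x | 0 < u x} ∩ f ⁻¹' {f x₁}).Nonempty
    · obtain ⟨x, hx, hmax⟩ := (husc.upperSemicontinuousOn _).exists_isMaxOn hne hK
      refine ⟨x, hx.2, fun z hz => ?_⟩
      by_cases h : 0 < u z
      · exact hmax ⟨subset_closure h, hz⟩
      · exact (not_lt.1 h).trans (h01 x).1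
    · refine ⟨x₁, rfl, fun z hz => ?_⟩
      by_cases h : 0 < u z
      · exact absurd ⟨z, subset_closure h, hz⟩ hne
      · exact (not_lt.1 h).trans (h01 x₁).1
  obtain ⟨x, hx, hm⟩ := key
  refine ⟨x, hx, ?_, hm⟩
  have hne : (f ⁻¹' {f x₁}).Nonempty := ⟨x₁, rfl⟩
  rw [zadeh, if_pos hne]
  refine IsGreatest.csSup_eq ⟨⟨x, hx, rfl⟩, ?_⟩
  rintro _ ⟨z, hz, rfl⟩
  exact hm z hz

/-- For every `α ∈ (0,1]`, the `α`-cut of `ρ ∘ f[u]` is the `f`-image of the `α`-cut of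
`ρ ∘ u`, and the supports agree likewise. -/
theorem cut_of_grey_zadeh {X : Type*} [TopologicalSpace X] [T2Space X]
    (f : X → X) (hf : Continuous f) (u : X → ℝ) (hu : IsFuzzyCompact u)
    (ρ : ℝ → ℝ) (hρ : IsGreyMap ρ) :
    (∀ α ∈ Set.Ioc (0 : ℝ) 1,
      {y | α ≤ ρ (zadeh f u y)} = f '' {x | α ≤ ρ (u x)}) ∧
    closure {y | 0 < ρ (zadeh f u y)} = f '' closure {x | 0 < ρ (u x)} := by
  have gen : ∀ P : ℝ → Prop, ¬ P 0 → (∀ a b, a ≤ b → P a → P b) →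
      {y | P (ρ (zadeh f u y))} = f '' {x | P (ρ (u x))} := by
    intro P h0 hP
    ext y
    constructor
    · intro hy
      by_cases hne : (f ⁻¹' {y}).Nonempty
      · obtain ⟨x₁, rfl⟩ := hne
        obtain ⟨x, hx, hz, -⟩ := zadeh_attained f hf u hu x₁
        refine ⟨x, ?_, hx⟩
        simpa only [mem_setOf_eq, hz] using hy
      · simp only [mem_setOf_eq, zadeh, if_neg hne, hρ.2.2.1] at hy
        exact absurd hy h0
    · rintro ⟨x₁, hx₁, rfl⟩
      obtain ⟨x, hx, hz, hm⟩ := zadeh_attained f hf u hu x₁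
      simp only [mem_setOf_eq, hz]
      exact hP _ _ (hρ.2.1 (hu.1 x₁) (hu.1 x) (hm x₁ rfl)) hx₁
  refine ⟨fun α hα => gen (fun t => α ≤ t) (not_le.2 hα.1) fun a b h h' => h'.trans h, ?_⟩
  rw [gen (fun t => 0 < t) (lt_irrefl _) fun a b h h' => h'.trans_le h]
  have hc : IsCompact (closure {x | 0 < ρ (u x)}) := by
    refine hu.2.2.2.of_isClosed_subset isClosed_closure (closure_mono fun x hx => ?_)
    rcases (hu.1 x).1.eq_or_lt with h | h
    · rw [mem_setOf_eq, ← h, hρ.2.2.1] at hx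
      exact absurd hx (lt_irrefl _)
    · exact h
  exact (closure_minimal (image_mono subset_closure) (hc.image hf).isClosed).antisymm
    (image_closure_subset_closure_image hf)
end

section
/- Let S_F = ((f_i)_{i=1}^k,(ρ_i)_{i=1}^k) be a fuzzy IFS on a Hausdorff topological space X and u ∈ K_F(X). Then for every α ∈ (0,1], [S_F(u)]^α = ⋃_{i=1}^k f_i([ρ_i∘u]^α), the support of S_F(u) equals ⋃_{i=1}^k f_i(support of ρ_i∘u), and consequently S_F(u) ∈ K_F(X). -/
open Filter Topology Set

/-- The fuzzy Hutchinson operator of a fuzzy IFS `((f i), (ρ i))`: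
`S_F(u) = max_i ρ i ∘ (f i)[u]` (pointwise maximum). -/
noncomputable def fuzzyHut {X : Type*} {k : ℕ} (f : Fin k → X → X) (ρ : Fin k → ℝ → ℝ)
    (u : X → ℝ) : X → ℝ :=
  fun x => ⨆ i, ρ i (zadeh (f i) u x)

theorem zadeh_spec {X : Type*} [TopologicalSpace X] [T2Space X] (f : X → X)
    (hf : Continuous f) (u : X → ℝ) (hu : IsFuzzyCompact u) (y : X) :
    (∀ x, f x = y → u x ≤ zadeh f u y) ∧
      (zadeh f u y = 0 ∨ ∃ x, f x = y ∧ u x = zadeh f u y) := by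
  obtain ⟨h01, -, husc, hc⟩ := hu
  by_cases hne : (f ⁻¹' {y}).Nonempty
  · have hz : zadeh f u y = sSup (u '' (f ⁻¹' {y})) := by simp only [zadeh, if_pos hne]
    have hb : BddAbove (u '' (f ⁻¹' {y})) := by
      refine ⟨1, ?_⟩
      rintro _ ⟨x, -, rfl⟩
      exact (h01 x).2
    have hle : ∀ x, f x = y → u x ≤ zadeh f u y := by
      intro x hx
      rw [hz]
      exact le_csSup hb ⟨x, hx, rfl⟩
    refine ⟨hle, ?_⟩
    by_cases hpos : ∃ x, f x = y ∧ 0 < u x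
    · right
      obtain ⟨x0, hx0, hx0p⟩ := hpos
      have hK : IsCompact (closure {x | 0 < u x} ∩ f ⁻¹' {y}) :=
        hc.inter_right (isClosed_singleton.preimage hf)
      obtain ⟨m, hm, hmax⟩ := (husc.upperSemicontinuousOn _).exists_isMaxOn
        (s := closure {x | 0 < u x} ∩ f ⁻¹' {y}) ⟨x0, subset_closure hx0p, hx0⟩ hK
      refine ⟨m, hm.2, le_antisymm (hle m hm.2) ?_⟩
      rw [hz]
      apply csSup_le (hne.image u)
      rintro _ ⟨x, hx, rfl⟩
      by_cases hxp : 0 < u x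
      · exact hmax ⟨subset_closure hxp, hx⟩
      · exact (not_lt.1 hxp).trans (h01 m).1
    · left
      push Not at hpos
      obtain ⟨x, hx⟩ := hne
      refine le_antisymm ?_ ((h01 x).1.trans (hle x hx))
      rw [hz]
      apply csSup_le (Set.Nonempty.image u ⟨x, hx⟩)
      rintro _ ⟨x, hx, rfl⟩
      exact hpos x hx
  · refine ⟨fun x hx => (hne ⟨x, hx⟩).elim, Or.inl ?_⟩
    simp only [zadeh, if_neg hne]

theorem grey_usc {X : Type*} [TopologicalSpace X] (ρ : ℝ → ℝ) (hρ : IsGreyMap ρ)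
    (u : X → ℝ) (h01 : ∀ x, u x ∈ Set.Icc (0 : ℝ) 1) (hu : UpperSemicontinuous u) :
    UpperSemicontinuous (fun x => ρ (u x)) := by
  obtain ⟨-, hmono, -, hcont⟩ := hρ
  intro x a hxa
  change ρ (u x) < a at hxa
  change ∀ᶠ x' in 𝓝 x, ρ (u x') < a
  rcases lt_or_eq_of_le (h01 x).2 with hlt | heq
  · have h1 := (hcont (u x) ⟨(h01 x).1, hlt⟩).eventually (gt_mem_nhds hxa)
    obtain ⟨ε, hε, hball⟩ := Metric.mem_nhdsWithin_iff.1 h1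
    filter_upwards [hu x (u x + ε) (by linarith)] with x' hx'
    rcases le_total (u x') (u x) with h | h
    · exact (hmono (h01 x') (h01 x) h).trans_lt hxa
    · apply hball
      refine ⟨?_, h, (h01 x').2⟩
      rw [Metric.mem_ball, Real.dist_eq, abs_lt]
      constructor <;> linarith
  · refine Filter.Eventually.of_forall fun x' => ?_
    exact (hmono (h01 x') (h01 x) (heq ▸ (h01 x').2)).trans_lt hxa

/-- For a fuzzy IFS on a Hausdorff space and `u ∈ K_F(X)`, the `α`-cuts of `S_F(u)` are
the unions of the `f i`-images of the `α`-cuts of `ρ i ∘ u`, the support of `S_F(u)` is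
the union of the `f i`-images of the supports of `ρ i ∘ u`, and `S_F(u) ∈ K_F(X)`. -/
theorem fuzzyHut_cuts_and_membership {X : Type*} [TopologicalSpace X] [T2Space X]
    (k : ℕ) (hk : 0 < k) (f : Fin k → X → X) (hf : ∀ i, Continuous (f i))
    (ρ : Fin k → ℝ → ℝ) (hρ : ∀ i, IsGreyMap (ρ i)) (hρ1 : ∃ j, ρ j 1 = 1)
    (u : X → ℝ) (hu : IsFuzzyCompact u) :
    (∀ α ∈ Set.Ioc (0 : ℝ) 1,
      {x | α ≤ fuzzyHut f ρ u x} = ⋃ i, f i '' {x | α ≤ ρ i (u x)}) ∧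
    closure {x | 0 < fuzzyHut f ρ u x} = (⋃ i, f i '' closure {x | 0 < ρ i (u x)}) ∧
    IsFuzzyCompact (fuzzyHut f ρ u) := by
  obtain ⟨h01, ⟨x1, hx1⟩, husc, hc⟩ := id hu
  haveI : Nonempty (Fin k) := ⟨⟨0, hk⟩⟩
  have hz := fun i y => zadeh_spec (f i) (hf i) u hu y
  have hz01 : ∀ i y, zadeh (f i) u y ∈ Set.Icc (0 : ℝ) 1 := by
    intro i y
    rcases (hz i y).2 with h | ⟨x, -, h⟩
    · rw [h]; simp
    · rw [← h]; exact h01 x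
  have hle : ∀ i y, ρ i (zadeh (f i) u y) ≤ fuzzyHut f ρ u y := fun i y =>
    le_ciSup (f := fun i => ρ i (zadeh (f i) u y)) (Set.finite_range _).bddAbove i
  have hex : ∀ y, ∃ i, ρ i (zadeh (f i) u y) = fuzzyHut f ρ u y := fun y =>
    exists_eq_ciSup_of_finite (f := fun i => ρ i (zadeh (f i) u y))
  have hge : ∀ i x, ρ i (u x) ≤ fuzzyHut f ρ u (f i x) := fun i x =>
    ((hρ i).2.1 (h01 x) (hz01 i _) ((hz i (f i x)).1 x rfl)).trans (hle i _)
  have hatt : ∀ y, 0 < fuzzyHut f ρ u y → ∃ i x, f i x = y ∧ ρ i (u x) = fuzzyHut f ρ u y := by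
    intro y hy
    obtain ⟨i, hi⟩ := hex y
    rcases (hz i y).2 with h | ⟨x, hx, h⟩
    · rw [h, (hρ i).2.2.1] at hi
      exact absurd hi hy.ne
    · exact ⟨i, x, hx, by rw [h, hi]⟩
  have hcut : ∀ α ∈ Set.Ioc (0 : ℝ) 1,
      {x | α ≤ fuzzyHut f ρ u x} = ⋃ i, f i '' {x | α ≤ ρ i (u x)} := by
    intro α hα
    ext y
    simp only [mem_setOf_eq, mem_iUnion, mem_image]
    constructor
    · intro h
      obtain ⟨i, x, hx, he⟩ := hatt y (hα.1.trans_le h)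
      exact ⟨i, x, he ▸ h, hx⟩
    · rintro ⟨i, x, h, rfl⟩
      exact h.trans (hge i x)
  have hpos : {x | 0 < fuzzyHut f ρ u x} = ⋃ i, f i '' {x | 0 < ρ i (u x)} := by
    ext y
    simp only [mem_setOf_eq, mem_iUnion, mem_image]
    constructor
    · intro h
      obtain ⟨i, x, hx, he⟩ := hatt y h
      exact ⟨i, x, he ▸ h, hx⟩
    · rintro ⟨i, x, h, rfl⟩
      exact h.trans_le (hge i x)
  have hsub : ∀ i, {x | 0 < ρ i (u x)} ⊆ {x | 0 < u x} := by
    intro i x hx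
    refine lt_of_le_of_ne (h01 x).1 fun h => ?_
    have hx' : 0 < ρ i (u x) := hx
    rw [← h, (hρ i).2.2.1] at hx'
    exact lt_irrefl _ hx'
  have hcomp : ∀ i, IsCompact (closure {x | 0 < ρ i (u x)}) := fun i =>
    hc.of_isClosed_subset isClosed_closure (closure_mono (hsub i))
  have hsupp : closure {x | 0 < fuzzyHut f ρ u x} =
      (⋃ i, f i '' closure {x | 0 < ρ i (u x)}) := by
    rw [hpos, closure_iUnion_of_finite]
    refine iUnion_congr fun i => ?_
    exact (image_closure_of_isCompact (hcomp i) (hf i).continuousOn).symm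
  have hval : ∀ y, fuzzyHut f ρ u y ∈ Set.Icc (0 : ℝ) 1 := by
    intro y
    obtain ⟨i, hi⟩ := hex y
    rw [← hi]
    exact (hρ i).1 _ (hz01 i y)
  refine ⟨hcut, hsupp, hval, ?_, ?_, ?_⟩
  · obtain ⟨j, hj⟩ := hρ1
    refine ⟨f j x1, le_antisymm (hval _).2 ?_⟩
    have := hge j x1
    rwa [hx1, hj] at this
  · rw [upperSemicontinuous_iff_isClosed_preimage]
    intro α
    change IsClosed {x | α ≤ fuzzyHut f ρ u x}
    rcases le_or_gt α 0 with h0 | h0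
    · convert isClosed_univ
      exact eq_univ_of_forall fun x => h0.trans (hval x).1
    rcases le_or_gt α 1 with h1 | h1
    · rw [hcut α ⟨h0, h1⟩]
      refine isClosed_iUnion_of_finite fun i => ?_
      have hcl : IsClosed {x | α ≤ ρ i (u x)} :=
        (upperSemicontinuous_iff_isClosed_preimage.1 (grey_usc (ρ i) (hρ i) u h01 husc)) α
      exact (((hcomp i).of_isClosed_subset hcl
        fun x hx => subset_closure (h0.trans_le hx)).image (hf i)).isClosed
    · convert isClosed_empty
      exact eq_empty_of_forall_notMem fun x hx => (h1.trans_le hx).not_ge (hval x).2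
  · rw [hsupp]
    exact isCompact_iUnion fun i => (hcomp i).image (hf i)
end

section
/- Let (X,D) be a multimetric space, with X carrying the topology τ_D. For every d ∈ D, the map d_{HF}(u,v) := sup_{α∈[0,1]} d_H([u]^α,[v]^α) is a pseudometric on K_F(X). If moreover D is directed, then the family D_{HF} := {d_{HF} : d ∈ D} is a multimetric on K_F(X): for all distinct u,v ∈ K_F(X) there exists d ∈ D with d_{HF}(u,v) > 0. -/
open Filter Topology Set

/-- The open ball of a pseudometric. -/
def pball {X : Type*} (d : X → X → ℝ) (x : X) (ε : ℝ) : Set X := {y | d x y < ε}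

/-- A multimetric: a family of pseudometrics separating points. -/
def IsMultimetric {X : Type*} (D : Set (X → X → ℝ)) : Prop :=
  (∀ d ∈ D, IsPseudometricFn d) ∧ ∀ x y : X, x ≠ y → ∃ d ∈ D, 0 < d x y

/-- A directed family of pseudometrics. -/
def IsDirectedMM {X : Type*} (D : Set (X → X → ℝ)) : Prop :=
  ∀ G : Finset (X → X → ℝ), ↑G ⊆ D → G.Nonempty →
    ∃ d ∈ D, ∀ g ∈ G, ∀ x y : X, g x y ≤ d x y

/-- `U` is open in the topology `τ_D` generated by the family of pseudometrics `D`. -/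
def IsTauOpen {X : Type*} (D : Set (X → X → ℝ)) (U : Set X) : Prop :=
  ∀ x ∈ U, ∃ ε > (0 : ℝ), ∃ G : Finset (X → X → ℝ), ↑G ⊆ D ∧ G.Nonempty ∧
    (⋂ d ∈ G, pball d x ε) ⊆ U

open Classical in
/-- The `α`-cut of a fuzzy set: `{u ≥ α}` for `α ≠ 0` and the closure of `{u > 0}`
for `α = 0`. -/
noncomputable def acut {X : Type*} [TopologicalSpace X] (u : X → ℝ) (α : ℝ) : Set X :=
  if α = 0 then closure {x | 0 < u x} else {x | α ≤ u x}

/-- The Hausdorff pseudodistance associated to a pseudometric `d`. -/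
noncomputable def hausPD {X : Type*} (d : X → X → ℝ) (K L : Set X) : ℝ :=
  max (sSup ((fun x => sInf ((fun y => d x y) '' L)) '' K))
      (sSup ((fun y => sInf ((fun x => d x y) '' K)) '' L))

/-- The fuzzy Hausdorff pseudodistance `d_{HF}(u,v) = sup_{α ∈ [0,1]} d_H([u]^α,[v]^α)`. -/
noncomputable def dHF {X : Type*} [TopologicalSpace X] (d : X → X → ℝ) (u v : X → ℝ) : ℝ :=
  sSup ((fun α => hausPD d (acut u α) (acut v α)) '' Set.Icc (0 : ℝ) 1)

theorem hausPD_nonneg' {X : Type*} {d : X → X → ℝ} (hd : IsPseudometricFn d) (K L : Set X) :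
    0 ≤ hausPD d K L := by
  refine le_max_of_le_left (Real.sSup_nonneg ?_)
  rintro _ ⟨x, _, rfl⟩
  refine Real.sInf_nonneg ?_
  rintro _ ⟨y, _, rfl⟩
  exact hd.1 x y

theorem hausPD_symm' {X : Type*} {d : X → X → ℝ} (hd : IsPseudometricFn d) (K L : Set X) :
    hausPD d K L = hausPD d L K := by
  have h : ∀ x y, d x y = d y x := hd.2.2.1
  unfold hausPD
  rw [max_comm]
  congr 1
  · simp only [fun y => funext (fun x => h x y)]
  · simp only [fun y => funext (fun x => h x y)]

theorem side_le {X : Type*} {d : X → X → ℝ} (hd : IsPseudometricFn d) {K L : Set X}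
    (hK : K.Nonempty) {r : ℝ}
    (h1 : ∀ x ∈ K, ∀ ε > 0, ∃ y ∈ L, d x y < r + ε) :
    sSup ((fun x => sInf ((fun y => d x y) '' L)) '' K) ≤ r := by
  refine csSup_le (hK.image _) ?_
  rintro _ ⟨x, hx, rfl⟩
  refine le_of_forall_pos_le_add fun ε hε => ?_
  obtain ⟨y, hy, hxy⟩ := h1 x hx ε hε
  refine le_trans (csInf_le ⟨0, ?_⟩ ⟨y, hy, rfl⟩) hxy.le
  rintro _ ⟨z, _, rfl⟩
  exact hd.1 x z

theorem hausPD_le' {X : Type*} {d : X → X → ℝ} (hd : IsPseudometricFn d) {K L : Set X}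
    (hK : K.Nonempty) (hL : L.Nonempty) {r : ℝ}
    (h1 : ∀ x ∈ K, ∀ ε > 0, ∃ y ∈ L, d x y < r + ε)
    (h2 : ∀ x ∈ L, ∀ ε > 0, ∃ y ∈ K, d x y < r + ε) :
    hausPD d K L ≤ r := by
  refine max_le (side_le hd hK h1) ?_
  have := side_le hd hL h2
  have h : ∀ x y, d x y = d y x := hd.2.2.1
  simpa only [fun y => funext (fun x => h x y)] using this

theorem exists_lt_hausPD {X : Type*} {d : X → X → ℝ} (hd : IsPseudometricFn d) {K L : Set X}
    (hL : L.Nonempty) {M : ℝ} (hM : ∀ x ∈ K, ∀ y ∈ L, d x y ≤ M) {x : X} (hx : x ∈ K)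
    {ε : ℝ} (hε : 0 < ε) : ∃ y ∈ L, d x y < hausPD d K L + ε := by
  have h1 : sInf ((fun y => d x y) '' L) ≤ hausPD d K L := by
    refine le_max_of_le_left (le_csSup ⟨M, ?_⟩ ⟨x, hx, rfl⟩)
    rintro _ ⟨z, hz, rfl⟩
    obtain ⟨y, hy⟩ := hL
    refine le_trans (csInf_le ⟨0, ?_⟩ ⟨y, hy, rfl⟩) (hM z hz y hy)
    rintro _ ⟨w, _, rfl⟩
    exact hd.1 z w
  obtain ⟨_, ⟨y, hy, rfl⟩, h⟩ := exists_lt_of_csInf_lt (hL.image (fun y => d x y))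
    (lt_of_le_of_lt h1 (lt_add_of_pos_right _ hε))
  exact ⟨y, hy, h⟩

theorem acut_nonempty' {X : Type*} [TopologicalSpace X] {u : X → ℝ} (hu : IsFuzzyCompact u)
    {α : ℝ} (hα : α ∈ Set.Icc (0 : ℝ) 1) : (acut u α).Nonempty := by
  obtain ⟨x, hx⟩ := hu.2.1
  refine ⟨x, ?_⟩
  unfold acut
  split_ifs
  · exact subset_closure (by simp [hx])
  · simpa [hx] using hα.2

theorem acut_subset' {X : Type*} [TopologicalSpace X] {u : X → ℝ}
    {α : ℝ} (hα : α ∈ Set.Icc (0 : ℝ) 1) : acut u α ⊆ closure {x | 0 < u x} := by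
  unfold acut
  split_ifs with h
  · exact subset_rfl
  · intro x hx
    exact subset_closure (lt_of_lt_of_le (lt_of_le_of_ne hα.1 (Ne.symm h)) hx)

theorem exists_bound' {X : Type*} [TopologicalSpace X] {D : Set (X → X → ℝ)}
    (hD : IsMultimetric D) (htop : ∀ U : Set X, IsOpen U ↔ IsTauOpen D U)
    {d : X → X → ℝ} (hdD : d ∈ D) (x : X) {K : Set X} (hK : IsCompact K) :
    ∃ M : ℝ, ∀ y ∈ K, d x y ≤ M := by
  have hd := hD.1 d hdD
  have ho : ∀ n : ℕ, IsOpen (pball d x n) := by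
    intro n
    rw [htop]
    intro y hy
    refine ⟨n - d x y, sub_pos.2 hy, {d}, by simpa using hdD, by simp, ?_⟩
    intro z hz
    have hz' : d y z < n - d x y := by simpa [pball] using hz
    have := hd.2.2.2 x z y
    show d x z < n
    linarith
  obtain ⟨n, hn⟩ := hK.elim_directed_cover (fun n : ℕ => pball d x n) ho
    (fun y _ => by
      obtain ⟨n, hn⟩ := exists_nat_gt (d x y)
      exact Set.mem_iUnion.2 ⟨n, hn⟩)
    (Monotone.directed_le (fun a b hab y hy => by
      have hy' : d x y < a := hy
      have : (a : ℝ) ≤ b := by exact_mod_cast hab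
      exact lt_of_lt_of_le hy' this))
  exact ⟨n, fun y hy => (show d x y < n from hn hy).le⟩

theorem exists_bound_pair {X : Type*} [TopologicalSpace X] {D : Set (X → X → ℝ)}
    (hD : IsMultimetric D) (htop : ∀ U : Set X, IsOpen U ↔ IsTauOpen D U)
    {d : X → X → ℝ} (hdD : d ∈ D) {u v : X → ℝ} (hu : IsFuzzyCompact u)
    (hv : IsFuzzyCompact v) :
    ∃ M : ℝ, ∀ α ∈ Set.Icc (0 : ℝ) 1, ∀ x ∈ acut u α, ∀ y ∈ acut v α, d x y ≤ M := by
  have hd := hD.1 d hdD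
  obtain ⟨x₀, -⟩ := hu.2.1
  obtain ⟨M, hM⟩ := exists_bound' hD htop hdD x₀ hu.2.2.2
  obtain ⟨N, hN⟩ := exists_bound' hD htop hdD x₀ hv.2.2.2
  refine ⟨M + N, fun α hα x hx y hy => ?_⟩
  have h1 := hM x (acut_subset' hα hx)
  have h2 := hN y (acut_subset' hα hy)
  have h3 := hd.2.2.2 x y x₀
  have h4 := hd.2.2.1 x x₀
  linarith

theorem hausPD_le_dHF {X : Type*} [TopologicalSpace X] {D : Set (X → X → ℝ)}
    (hD : IsMultimetric D) (htop : ∀ U : Set X, IsOpen U ↔ IsTauOpen D U)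
    {d : X → X → ℝ} (hdD : d ∈ D) {u v : X → ℝ} (hu : IsFuzzyCompact u)
    (hv : IsFuzzyCompact v) {α : ℝ} (hα : α ∈ Set.Icc (0 : ℝ) 1) :
    hausPD d (acut u α) (acut v α) ≤ dHF d u v := by
  have hd := hD.1 d hdD
  obtain ⟨M, hM⟩ := exists_bound_pair hD htop hdD hu hv
  refine le_csSup ⟨M, ?_⟩ ⟨α, hα, rfl⟩
  rintro _ ⟨β, hβ, rfl⟩
  refine hausPD_le' hd (acut_nonempty' hu hβ) (acut_nonempty' hv hβ) ?_ ?_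
  · intro x hx ε hε
    obtain ⟨y, hy⟩ := acut_nonempty' hv hβ
    exact ⟨y, hy, by linarith [hM β hβ x hx y hy]⟩
  · intro x hx ε hε
    obtain ⟨y, hy⟩ := acut_nonempty' hu hβ
    exact ⟨y, hy, by linarith [hM β hβ y hy x hx, hd.2.2.1 x y]⟩

theorem exists_lt_dHF {X : Type*} [TopologicalSpace X] {D : Set (X → X → ℝ)}
    (hD : IsMultimetric D) (htop : ∀ U : Set X, IsOpen U ↔ IsTauOpen D U)
    {d : X → X → ℝ} (hdD : d ∈ D) {u v : X → ℝ} (hu : IsFuzzyCompact u)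
    (hv : IsFuzzyCompact v) {α : ℝ} (hα : α ∈ Set.Icc (0 : ℝ) 1) {x : X} (hx : x ∈ acut u α)
    {ε : ℝ} (hε : 0 < ε) : ∃ y ∈ acut v α, d x y < dHF d u v + ε := by
  obtain ⟨M, hM⟩ := exists_bound_pair hD htop hdD hu hv
  obtain ⟨y, hy, h⟩ := exists_lt_hausPD (hD.1 d hdD) (acut_nonempty' hv hα) (hM α hα) hx hε
  exact ⟨y, hy, by linarith [hausPD_le_dHF hD htop hdD hu hv hα]⟩

theorem dHF_symm' {X : Type*} [TopologicalSpace X] {d : X → X → ℝ} (hd : IsPseudometricFn d)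
    (u v : X → ℝ) : dHF d u v = dHF d v u := by
  unfold dHF
  simp only [fun α => hausPD_symm' hd (acut u α) (acut v α)]

theorem dHF_sep {X : Type*} [TopologicalSpace X] {D : Set (X → X → ℝ)}
    (hD : IsMultimetric D) (htop : ∀ U : Set X, IsOpen U ↔ IsTauOpen D U)
    (hdir : IsDirectedMM D) {u v : X → ℝ} (hu : IsFuzzyCompact u)
    (hv : IsFuzzyCompact v) {x : X} (hx : v x < u x) : ∃ d ∈ D, 0 < dHF d u v := by
  have hα : u x ∈ Set.Icc (0 : ℝ) 1 := hu.1 x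
  have hpos : u x ≠ 0 := (lt_of_le_of_lt (hv.1 x).1 hx).ne'
  have ho : IsOpen (v ⁻¹' Set.Iio (u x)) := hv.2.2.1.isOpen_preimage (u x)
  obtain ⟨ε, hε, G, hG, hne, hsub⟩ := (htop _).1 ho x hx
  obtain ⟨d, hdD, hd⟩ := hdir G hG hne
  refine ⟨d, hdD, ?_⟩
  by_contra hcon
  obtain ⟨y, hy, hxy⟩ := exists_lt_dHF hD htop hdD hu hv hα
    (x := x) (by simp [acut, hpos]) hε
  have h1 : y ∈ v ⁻¹' Set.Iio (u x) := by
    apply hsub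
    simp only [Set.mem_iInter]
    intro g hg
    show g x y < ε
    linarith [hd g hg x y]
  have h2 : u x ≤ v y := by simpa [acut, hpos] using hy
  exact absurd h1 (not_lt.2 h2)

/-- For a multimetric space `(X,D)` (with `X` carrying the topology `τ_D`), each `d_{HF}`
is a pseudometric on `K_F(X)`, and if `D` is directed then the family
`{d_{HF} : d ∈ D}` separates points of `K_F(X)`. -/
theorem dHF_multimetric {X : Type*} [TopologicalSpace X] (D : Set (X → X → ℝ))
    (hD : IsMultimetric D) (htop : ∀ U : Set X, IsOpen U ↔ IsTauOpen D U) :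
    (∀ d ∈ D,
      (∀ u v : X → ℝ, IsFuzzyCompact u → IsFuzzyCompact v → 0 ≤ dHF d u v) ∧
      (∀ u : X → ℝ, IsFuzzyCompact u → dHF d u u = 0) ∧
      (∀ u v : X → ℝ, IsFuzzyCompact u → IsFuzzyCompact v → dHF d u v = dHF d v u) ∧
      (∀ u v w : X → ℝ, IsFuzzyCompact u → IsFuzzyCompact v → IsFuzzyCompact w →
        dHF d u v ≤ dHF d u w + dHF d w v)) ∧
    (IsDirectedMM D → ∀ u v : X → ℝ, IsFuzzyCompact u → IsFuzzyCompact v → u ≠ v →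
      ∃ d ∈ D, 0 < dHF d u v) := by
  refine ⟨fun d hdD => ?_, fun hdir u v hu hv huv => ?_⟩
  · have hd := hD.1 d hdD
    have hIcc : (Set.Icc (0 : ℝ) 1).Nonempty := ⟨0, by simp⟩
    have hnn : ∀ u v : X → ℝ, 0 ≤ dHF d u v := by
      intro u v
      refine Real.sSup_nonneg ?_
      rintro _ ⟨α, _, rfl⟩
      exact hausPD_nonneg' hd _ _
    have htri : ∀ u v w : X → ℝ, IsFuzzyCompact u → IsFuzzyCompact v → IsFuzzyCompact w →
        ∀ α ∈ Set.Icc (0 : ℝ) 1, ∀ x ∈ acut u α, ∀ ε > 0, ∃ y ∈ acut v α,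
          d x y < dHF d u w + dHF d w v + ε := by
      intro u v w hu hv hw α hα x hx ε hε
      obtain ⟨z, hz, h1⟩ := exists_lt_dHF hD htop hdD hu hw hα hx (half_pos hε)
      obtain ⟨y, hy, h2⟩ := exists_lt_dHF hD htop hdD hw hv hα hz (half_pos hε)
      exact ⟨y, hy, by linarith [hd.2.2.2 x y z]⟩
    refine ⟨fun u v _ _ => hnn u v, fun u hu => le_antisymm ?_ (hnn u u),
      fun u v _ _ => dHF_symm' hd u v, fun u v w hu hv hw => ?_⟩
    · refine csSup_le (hIcc.image _) ?_
      rintro _ ⟨α, hα, rfl⟩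
      have h : ∀ x ∈ acut u α, ∀ ε > 0, ∃ y ∈ acut u α, d x y < 0 + ε :=
        fun x hx ε hε => ⟨x, hx, by linarith [hd.2.1 x]⟩
      exact hausPD_le' hd (acut_nonempty' hu hα) (acut_nonempty' hu hα) h h
    · refine csSup_le (hIcc.image _) ?_
      rintro _ ⟨α, hα, rfl⟩
      refine hausPD_le' hd (acut_nonempty' hu hα) (acut_nonempty' hv hα)
        (htri u v w hu hv hw α hα) ?_
      rw [dHF_symm' hd u w, dHF_symm' hd w v, add_comm]
      exact htri v u w hv hu hw α hα
  · obtain ⟨x, hx⟩ := Function.ne_iff.1 huv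
    rcases lt_or_gt_of_ne hx with h | h
    · obtain ⟨d, hdD, hp⟩ := dHF_sep hD htop hdir hv hu h
      exact ⟨d, hdD, by rwa [dHF_symm' (hD.1 d hdD)]⟩
    · exact dHF_sep hD htop hdir hu hv h
end

section
/- Let X carry the topology τ_D generated by a directed multimetric D, let u₀ ∈ K_F(X), and let U ⊆ X×[0,1] be open in the product topology with hypo(u₀) ⊆ U. Then there exist d ∈ D and ε > 0 such that every u ∈ K_F(X) with d_{HF}(u,u₀) < ε satisfies hypo(u) ⊆ U. (Together with the corresponding statement for sets hitting U, this shows that on a Tychonoff space the h-topology induced by hypographs via the Vietoris topology is coarser than the M-topology: τ_h ⊆ τ_M.) -/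
open Filter Topology Set

/-- The hypograph of a fuzzy set `u ∈ K_F(X)`, as a subset of `X × ℝ`:
`{(x,α) : x ∈ [u]^0, 0 ≤ α ≤ u(x)}`. -/
def hypo {X : Type*} [TopologicalSpace X] (u : X → ℝ) : Set (X × ℝ) :=
  {p | p.1 ∈ closure {x | 0 < u x} ∧ 0 ≤ p.2 ∧ p.2 ≤ u p.1}


theorem pball_isOpen_aux {X : Type*} [TopologicalSpace X]
    {D : Set (X → X → ℝ)} (hD : IsMultimetric D)
    (htop : ∀ U : Set X, IsOpen U ↔ IsTauOpen D U) {d : X → X → ℝ} (hd : d ∈ D)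
    (x : X) (r : ℝ) : IsOpen (pball d x r) := by
  rw [htop]
  intro y hy
  have hy' : d x y < r := hy
  refine ⟨r - d x y, by linarith, {d}, by simpa using hd, by simp, ?_⟩
  intro z hz
  simp only [Finset.mem_singleton, iInter_iInter_eq_left] at hz
  have hz' : d y z < r - d x y := hz
  have := (hD.1 d hd).2.2.2 x z y
  show d x z < r
  linarith

theorem bdd_aux {X : Type*} [TopologicalSpace X]
    {D : Set (X → X → ℝ)} (hD : IsMultimetric D)
    (htop : ∀ U : Set X, IsOpen U ↔ IsTauOpen D U) {d : X → X → ℝ} (hd : d ∈ D)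
    (x : X) {K : Set X} (hK : IsCompact K) : ∃ M : ℝ, ∀ y ∈ K, d x y ≤ M := by
  refine hK.induction_on (p := fun s => ∃ M : ℝ, ∀ y ∈ s, d x y ≤ M) ⟨0, by simp⟩ ?_ ?_ ?_
  · rintro s t hst ⟨M, hM⟩
    exact ⟨M, fun y hy => hM y (hst hy)⟩
  · rintro s t ⟨M, hM⟩ ⟨N, hN⟩
    refine ⟨max M N, ?_⟩
    rintro y (hy | hy)
    · exact (hM y hy).trans (le_max_left _ _)
    · exact (hN y hy).trans (le_max_right _ _)
  · intro y _
    refine ⟨pball d y 1, mem_nhdsWithin_of_mem_nhds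
      ((pball_isOpen_aux hD htop hd y 1).mem_nhds ?_), d x y + 1, ?_⟩
    · show d y y < 1
      rw [(hD.1 d hd).2.1]; norm_num
    · intro z hz
      have hz' : d y z < 1 := hz
      have := (hD.1 d hd).2.2.2 x z y
      linarith

theorem acut_subset_aux {X : Type*} [TopologicalSpace X] (u : X → ℝ) {α : ℝ} (hα : 0 ≤ α) :
    acut u α ⊆ closure {x | 0 < u x} := by
  unfold acut
  split_ifs with h
  · exact subset_rfl
  · intro x hx
    exact subset_closure (lt_of_lt_of_le (lt_of_le_of_ne hα (Ne.symm h)) hx)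

theorem acut_nonempty_aux {X : Type*} [TopologicalSpace X] {u : X → ℝ}
    (hu : IsFuzzyCompact u) {α : ℝ} (hα : α ≤ 1) : (acut u α).Nonempty := by
  obtain ⟨x, hx⟩ := hu.2.1
  refine ⟨x, ?_⟩
  unfold acut
  split_ifs with h
  · exact subset_closure (by simp [hx])
  · simpa [hx] using hα

theorem close_aux {X : Type*} [TopologicalSpace X]
    {D : Set (X → X → ℝ)} (hD : IsMultimetric D)
    (htop : ∀ U : Set X, IsOpen U ↔ IsTauOpen D U) {d : X → X → ℝ} (hd : d ∈ D)
    {u v : X → ℝ} (hu : IsFuzzyCompact u) (hv : IsFuzzyCompact v) {ε : ℝ}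
    (h : dHF d u v < ε) {α : ℝ} (hα : α ∈ Icc (0 : ℝ) 1) {x : X} (hx : x ∈ acut u α) :
    ∃ y ∈ acut v α, d x y < ε := by
  obtain ⟨hnn, -, hsymm, htri⟩ := hD.1 d hd
  obtain ⟨M, hM⟩ := bdd_aux hD htop hd x hu.2.2.2
  obtain ⟨N, hN⟩ := bdd_aux hD htop hd x hv.2.2.2
  have hM0 : 0 ≤ M := (hnn x x).trans (hM x (acut_subset_aux u hα.1 hx))
  have hN0 : 0 ≤ N := by
    obtain ⟨y, hy⟩ := acut_nonempty_aux hv hα.2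
    exact (hnn x y).trans (hN y (acut_subset_aux v hα.1 hy))
  have key : ∀ a ∈ closure {x | 0 < u x}, ∀ b ∈ closure {x | 0 < v x}, d a b ≤ M + N := by
    intro a ha b hb
    have h1 := htri a b x
    have h2 := hM a ha
    have h3 := hN b hb
    rw [hsymm] at h2
    linarith
  have b1 : ∀ β ∈ Icc (0 : ℝ) 1,
      ∀ t ∈ (fun x => sInf ((fun y => d x y) '' acut v β)) '' acut u β, t ≤ M + N := by
    rintro β hβ _ ⟨a, ha, rfl⟩
    obtain ⟨b, hb⟩ := acut_nonempty_aux hv hβ.2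
    refine (csInf_le ⟨0, ?_⟩ (mem_image_of_mem _ hb)).trans
      (key a (acut_subset_aux u hβ.1 ha) b (acut_subset_aux v hβ.1 hb))
    rintro _ ⟨c, -, rfl⟩
    exact hnn _ _
  have b2 : ∀ β ∈ Icc (0 : ℝ) 1,
      ∀ t ∈ (fun y => sInf ((fun x => d x y) '' acut u β)) '' acut v β, t ≤ M + N := by
    rintro β hβ _ ⟨b, hb, rfl⟩
    obtain ⟨a, ha⟩ := acut_nonempty_aux hu hβ.2
    refine (csInf_le ⟨0, ?_⟩ (mem_image_of_mem (fun x => d x b) ha)).trans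
      (key a (acut_subset_aux u hβ.1 ha) b (acut_subset_aux v hβ.1 hb))
    rintro _ ⟨c, -, rfl⟩
    exact hnn _ _
  have b3 : BddAbove ((fun α => hausPD d (acut u α) (acut v α)) '' Set.Icc (0 : ℝ) 1) := by
    refine ⟨M + N, ?_⟩
    rintro _ ⟨β, hβ, rfl⟩
    exact max_le (Real.sSup_le (b1 β hβ) (by linarith)) (Real.sSup_le (b2 β hβ) (by linarith))
  have h1 : hausPD d (acut u α) (acut v α) ≤ dHF d u v := le_csSup b3 (mem_image_of_mem _ hα)
  have h2 : sInf ((fun y => d x y) '' acut v α) ≤ hausPD d (acut u α) (acut v α) :=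
    (le_csSup ⟨M + N, b1 α hα⟩ (mem_image_of_mem _ hx)).trans (le_max_left _ _)
  obtain ⟨_, ⟨y, hy, rfl⟩, hlt⟩ := exists_lt_of_csInf_lt
    ((acut_nonempty_aux hv hα.2).image _) ((h2.trans h1).trans_lt h)
  exact ⟨y, hy, hlt⟩

theorem hypo_compact_aux {X : Type*} [TopologicalSpace X] {u : X → ℝ}
    (hu : IsFuzzyCompact u) : IsCompact (hypo u) := by
  have hc : IsClosed {p : X × ℝ | p.2 ≤ u p.1} := by
    rw [← isOpen_compl_iff, isOpen_iff_mem_nhds]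
    rintro ⟨x, a⟩ hx
    have hx' : u x < a := not_le.1 hx
    obtain ⟨c, h1, h2⟩ := exists_between hx'
    have := hu.2.2.1 x c h1
    filter_upwards [prod_mem_nhds this (Ioi_mem_nhds h2)] with p hp
    have h3 : u p.1 < c := hp.1
    have h4 : c < p.2 := hp.2
    exact not_le.2 (h3.trans h4)
  have : hypo u = (closure {x | 0 < u x} ×ˢ Icc (0 : ℝ) 1) ∩ {p : X × ℝ | p.2 ≤ u p.1} := by
    ext p
    constructor
    · rintro ⟨h1, h2, h3⟩
      exact ⟨⟨h1, h2, h3.trans (hu.1 _).2⟩, h3⟩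
    · rintro ⟨⟨h1, h2, -⟩, h3⟩
      exact ⟨h1, h2, h3⟩
  rw [this]
  exact (hu.2.2.2.prod isCompact_Icc).inter_right hc

/-- If `U` is open (in the product topology) and contains the hypograph of
`u₀ ∈ K_F(X)`, then some `d_{HF}`-ball around `u₀` consists of fuzzy sets whose
hypographs are contained in `U`. (Together with the corresponding statement for sets
meeting `U`, this shows that on a Tychonoff space the h-topology is coarser than the
M-topology: `τ_h ⊆ τ_M`.) -/
theorem hypo_subset_open_of_dHF_close {X : Type*} [TopologicalSpace X]
    (D : Set (X → X → ℝ)) (hD : IsMultimetric D) (hDd : IsDirectedMM D)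
    (htop : ∀ U : Set X, IsOpen U ↔ IsTauOpen D U)
    (u₀ : X → ℝ) (hu₀ : IsFuzzyCompact u₀)
    (U : Set (X × ℝ)) (hU : IsOpen U) (hsub : hypo u₀ ⊆ U) :
    ∃ d ∈ D, ∃ ε > (0 : ℝ), ∀ u : X → ℝ, IsFuzzyCompact u → dHF d u u₀ < ε →
      hypo u ⊆ U := by
  classical
  have hDne : ∃ d, d ∈ D := by
    obtain ⟨x, -⟩ := hu₀.2.1
    obtain ⟨_, _, G, hG, ⟨g, hg⟩, -⟩ := (htop univ).1 isOpen_univ x (mem_univ x)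
    exact ⟨g, hG hg⟩
  have main : ∃ d ∈ D, ∃ ε > (0 : ℝ), ∀ p ∈ hypo u₀, ∀ x, d p.1 x < ε → (x, p.2) ∈ U := by
    refine (hypo_compact_aux hu₀).induction_on (p := fun s => ∃ d ∈ D, ∃ ε > (0 : ℝ),
      ∀ p ∈ s, ∀ x, d p.1 x < ε → (x, p.2) ∈ U) ?_ ?_ ?_ ?_
    · obtain ⟨d, hd⟩ := hDne
      exact ⟨d, hd, 1, one_pos, by simp⟩
    · rintro s t hst ⟨d, hd, ε, hε, h⟩
      exact ⟨d, hd, ε, hε, fun p hp => h p (hst hp)⟩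
    · rintro s t ⟨d, hd, ε, hε, h⟩ ⟨e, he, δ, hδ, h'⟩
      obtain ⟨f, hf, hle⟩ := hDd {d, e} (by
        intro g hg
        simp only [Finset.coe_insert, Finset.coe_singleton, mem_insert_iff,
          mem_singleton_iff] at hg
        rcases hg with rfl | rfl <;> assumption) (by simp)
      refine ⟨f, hf, min ε δ, lt_min hε hδ, ?_⟩
      rintro p (hp | hp) x hx
      · exact h p hp x ((hle d (by simp) _ _).trans_lt (hx.trans_le (min_le_left _ _)))
      · exact h' p hp x ((hle e (by simp) _ _).trans_lt (hx.trans_le (min_le_right _ _)))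
    · rintro ⟨x, a⟩ hp
      obtain ⟨V, W, hV, hW, hxV, haW, hVW⟩ := isOpen_prod_iff.1 hU x a (hsub hp)
      obtain ⟨ε, hε, G, hG, hGne, hGV⟩ := (htop V).1 hV x hxV
      obtain ⟨d, hd, hle⟩ := hDd G hG hGne
      refine ⟨pball d x (ε / 2) ×ˢ W, mem_nhdsWithin_of_mem_nhds
        (prod_mem_nhds ((pball_isOpen_aux hD htop hd x _).mem_nhds ?_) (hW.mem_nhds haW)),
        d, hd, ε / 2, by linarith, ?_⟩
      · show d x x < ε / 2
        rw [(hD.1 d hd).2.1]; linarith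
      · rintro ⟨y, b⟩ ⟨hy, hb⟩ z hz
        have hy' : d x y < ε / 2 := hy
        have hz' : d y z < ε / 2 := hz
        refine hVW ⟨hGV ?_, hb⟩
        simp only [mem_iInter]
        intro g hg
        have h1 := hle g hg x z
        have h2 := (hD.1 d hd).2.2.2 x z y
        show g x z < ε
        linarith
  obtain ⟨d, hd, ε, hε, h⟩ := main
  refine ⟨d, hd, ε, hε, ?_⟩
  rintro u hu hlt ⟨x, α⟩ ⟨h1, h2, h3⟩
  have h1' : x ∈ closure {x | 0 < u x} := h1
  have h2' : 0 ≤ α := h2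
  have h3' : α ≤ u x := h3
  have hα : α ∈ Icc (0 : ℝ) 1 := ⟨h2', h3'.trans (hu.1 x).2⟩
  have hx : x ∈ acut u α := by
    unfold acut
    split_ifs
    · exact h1'
    · exact h3'
  obtain ⟨y, hy, hxy⟩ := close_aux hD htop hd hu hu₀ hlt hα hx
  refine h (y, α) ⟨acut_subset_aux u₀ h2' hy, h2', ?_⟩ x ?_
  · show α ≤ u₀ y
    unfold acut at hy
    split_ifs at hy with h0
    · rw [h0]; exact (hu₀.1 y).1
    · exact hy
  · show d y x < ε
    rw [(hD.1 d hd).2.2.1]; exact hxy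
end

section
/- Let d be a continuous pseudometric on a Hausdorff topological space X and let ρ:[0,1]→[0,1] be nondecreasing, right continuous with ρ(0)=0. Then for all u,v ∈ K_F(X) and every α ∈ [0,1] such that the cuts [ρ∘u]^α and [ρ∘v]^α are nonempty (they are simultaneously empty or nonempty), one has d_H([ρ∘u]^α,[ρ∘v]^α) ≤ d_{HF}(u,v). -/
open Filter Topology Set

lemma hausPD_symm_aux {X : Type*} (d : X → X → ℝ) (hd : IsPseudometricFn d) (K L : Set X) :
    hausPD d K L = hausPD d L K := by
  have h : ∀ x y, d x y = d y x := hd.2.2.1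
  unfold hausPD
  rw [max_comm]
  congr 1
  · congr 2; funext y; congr 2; funext x; exact h x y
  · congr 2; funext y; congr 2; funext x; exact h y x

lemma dHF_symm_aux {X : Type*} [TopologicalSpace X] (d : X → X → ℝ) (hd : IsPseudometricFn d)
    (u v : X → ℝ) : dHF d u v = dHF d v u := by
  unfold dHF
  congr 2; funext α; exact hausPD_symm_aux d hd _ _

lemma half_le_aux {X : Type*} (d : X → X → ℝ) (hd : IsPseudometricFn d) (K L : Set X) (D : ℝ)
    (hD : 0 ≤ D) (h : ∀ x ∈ K, ∀ ε > 0, ∃ y ∈ L, d x y < D + ε) :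
    sSup ((fun x => sInf ((fun y => d x y) '' L)) '' K) ≤ D := by
  apply Real.sSup_le _ hD
  rintro _ ⟨x, hx, rfl⟩
  refine le_of_forall_pos_le_add fun ε hε => ?_
  obtain ⟨y, hy, hxy⟩ := h x hx ε hε
  refine le_trans (csInf_le ⟨0, ?_⟩ ⟨y, hy, rfl⟩) hxy.le
  rintro _ ⟨z, -, rfl⟩
  exact hd.1 x z

lemma hausPD_le_aux {X : Type*} (d : X → X → ℝ) (hd : IsPseudometricFn d) (K L : Set X) (D : ℝ)
    (hD : 0 ≤ D) (h : ∀ x ∈ K, ∀ ε > 0, ∃ y ∈ L, d x y < D + ε)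
    (h' : ∀ x ∈ L, ∀ ε > 0, ∃ y ∈ K, d x y < D + ε) :
    hausPD d K L ≤ D := by
  have h2 := half_le_aux d hd L K D hD h'
  refine max_le (half_le_aux d hd K L D hD h) ?_
  have e : (fun y => sInf ((fun x => d x y) '' K)) = fun x => sInf ((fun y => d x y) '' K) := by
    funext y; congr 2; funext x; exact hd.2.2.1 x y
  rw [e]
  exact h2

lemma acut_sub_aux {X : Type*} [TopologicalSpace X] (u : X → ℝ) (α : ℝ) (hα : 0 ≤ α) :
    acut u α ⊆ closure {x | 0 < u x} := by
  unfold acut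
  split_ifs with h
  · exact le_rfl
  · intro x hx
    exact subset_closure (lt_of_lt_of_le (lt_of_le_of_ne hα (Ne.symm h)) hx)

lemma acut_ne_aux {X : Type*} [TopologicalSpace X] (u : X → ℝ) (hu : IsFuzzyCompact u)
    (α : ℝ) (hα : α ≤ 1) : (acut u α).Nonempty := by
  obtain ⟨x, hx⟩ := hu.2.1
  refine ⟨x, ?_⟩
  unfold acut
  split_ifs with h
  · exact subset_closure (by simp [hx])
  · simpa [hx] using hα

lemma bound_aux {X : Type*} [TopologicalSpace X] (d : X → X → ℝ)
    (hdc : Continuous fun p : X × X => d p.1 p.2) (u v : X → ℝ)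
    (hu : IsFuzzyCompact u) (hv : IsFuzzyCompact v) :
    ∃ M, ∀ x ∈ closure {x | 0 < u x}, ∀ y ∈ closure {x | 0 < v x}, d x y ≤ M := by
  obtain ⟨M, hM⟩ := (hu.2.2.2.prod hv.2.2.2).bddAbove_image hdc.continuousOn
  exact ⟨M, fun x hx y hy => hM ⟨(x, y), ⟨hx, hy⟩, rfl⟩⟩

lemma dHF_bdd_aux {X : Type*} [TopologicalSpace X] (d : X → X → ℝ) (hd : IsPseudometricFn d)
    (hdc : Continuous fun p : X × X => d p.1 p.2) (u v : X → ℝ)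
    (hu : IsFuzzyCompact u) (hv : IsFuzzyCompact v) :
    BddAbove ((fun α => hausPD d (acut u α) (acut v α)) '' Set.Icc (0 : ℝ) 1) := by
  obtain ⟨M, hM⟩ := bound_aux d hdc u v hu hv
  refine ⟨max M 0, ?_⟩
  rintro _ ⟨α, hα, rfl⟩
  refine hausPD_le_aux d hd _ _ _ (le_max_right _ _) ?_ ?_
  · intro x hx ε hε
    obtain ⟨y, hy⟩ := acut_ne_aux v hv α hα.2
    have := hM x (acut_sub_aux u α hα.1 hx) y (acut_sub_aux v α hα.1 hy)
    exact ⟨y, hy, by linarith [le_max_left M 0]⟩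
  · intro x hx ε hε
    obtain ⟨y, hy⟩ := acut_ne_aux u hu α hα.2
    have := hM y (acut_sub_aux u α hα.1 hy) x (acut_sub_aux v α hα.1 hx)
    exact ⟨y, hy, by rw [hd.2.2.1]; linarith [le_max_left M 0]⟩

lemma dHF_nonneg_aux {X : Type*} [TopologicalSpace X] (d : X → X → ℝ) (hd : IsPseudometricFn d)
    (u v : X → ℝ) : 0 ≤ dHF d u v := by
  apply Real.sSup_nonneg
  rintro _ ⟨α, hα, rfl⟩
  refine le_max_of_le_left (Real.sSup_nonneg ?_)
  rintro _ ⟨x, hx, rfl⟩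
  refine Real.sInf_nonneg ?_
  rintro _ ⟨y, hy, rfl⟩
  exact hd.1 x y

lemma key_aux {X : Type*} [TopologicalSpace X] (d : X → X → ℝ) (hd : IsPseudometricFn d)
    (hdc : Continuous fun p : X × X => d p.1 p.2) (u v : X → ℝ)
    (hu : IsFuzzyCompact u) (hv : IsFuzzyCompact v) (x : X) (hx : 0 < u x) (ε : ℝ) (hε : 0 < ε) :
    ∃ y, u x ≤ v y ∧ d x y < dHF d u v + ε := by
  have hux := hu.1 x
  obtain ⟨M, hM⟩ := bound_aux d hdc u v hu hv
  have h1 : hausPD d (acut u (u x)) (acut v (u x)) ≤ dHF d u v :=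
    le_csSup (dHF_bdd_aux d hd hdc u v hu hv) ⟨u x, hux, rfl⟩
  have hxm : x ∈ acut u (u x) := by
    unfold acut; rw [if_neg hx.ne']; exact le_refl (u x)
  have hne := acut_ne_aux v hv (u x) hux.2
  have h2 : sInf ((fun y => d x y) '' acut v (u x)) ≤ hausPD d (acut u (u x)) (acut v (u x)) := by
    refine le_trans (le_csSup (s := (fun z => sInf ((fun y => d z y) '' acut v (u x))) '' acut u (u x))
      ⟨M, ?_⟩ ⟨x, hxm, rfl⟩) (le_max_left _ _)
    rintro _ ⟨z, hz, rfl⟩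
    obtain ⟨y, hy⟩ := hne
    refine le_trans (csInf_le ⟨0, ?_⟩ ⟨y, hy, rfl⟩)
      (hM z (acut_sub_aux u _ hux.1 hz) y (acut_sub_aux v _ hux.1 hy))
    rintro _ ⟨w, -, rfl⟩
    exact hd.1 z w
  obtain ⟨_, ⟨y, hy, rfl⟩, hlt⟩ := exists_lt_of_csInf_lt (hne.image (fun y => d x y))
    (lt_of_le_of_lt (h2.trans h1) (lt_add_of_pos_right _ hε))
  refine ⟨y, ?_, hlt⟩
  unfold acut at hy; rw [if_neg hx.ne'] at hy; exact hy

lemma side_aux {X : Type*} [TopologicalSpace X] (d : X → X → ℝ) (hd : IsPseudometricFn d)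
    (hdc : Continuous fun p : X × X => d p.1 p.2) (ρ : ℝ → ℝ) (hρ : IsGreyMap ρ) (u v : X → ℝ)
    (hu : IsFuzzyCompact u) (hv : IsFuzzyCompact v) (α : ℝ) (hα : α ∈ Set.Icc (0 : ℝ) 1) :
    ∀ x ∈ acut (fun x => ρ (u x)) α, ∀ ε > 0,
      ∃ y ∈ acut (fun x => ρ (v x)) α, d x y < dHF d u v + ε := by
  have hpos : ∀ x, 0 < ρ (u x) → 0 < u x := by
    intro x hx
    refine lt_of_le_of_ne (hu.1 x).1 fun h => ?_
    rw [← h, hρ.2.2.1] at hx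
    exact lt_irrefl _ hx
  have base : ∀ x, 0 < ρ (u x) → ∀ ε > 0, ∃ y, ρ (u x) ≤ ρ (v y) ∧ d x y < dHF d u v + ε := by
    intro x hx ε hε
    obtain ⟨y, hy, hxy⟩ := key_aux d hd hdc u v hu hv x (hpos x hx) ε hε
    exact ⟨y, hρ.2.1 (hu.1 x) (hv.1 y) hy, hxy⟩
  intro x hx ε hε
  unfold acut at hx ⊢
  split_ifs at hx ⊢ with h
  · have hopen : IsOpen {z | d x z < ε / 2} :=
      isOpen_lt (hdc.comp (Continuous.prodMk_right x)) continuous_const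
    obtain ⟨z, hz, hzu⟩ := mem_closure_iff.1 hx _ hopen (by
      change d x x < ε / 2; rw [hd.2.1]; linarith)
    obtain ⟨y, hy, hzy⟩ := base z hzu (ε / 2) (by linarith)
    have hzu' : 0 < ρ (u z) := hzu
    have hz' : d x z < ε / 2 := hz
    exact ⟨y, subset_closure (lt_of_lt_of_le hzu' hy), by linarith [hd.2.2.2 x y z]⟩
  · have hx' : α ≤ ρ (u x) := hx
    obtain ⟨y, hy, hxy⟩ := base x (lt_of_lt_of_le (lt_of_le_of_ne hα.1 (Ne.symm h)) hx') ε hε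
    exact ⟨y, hx'.trans hy, hxy⟩

/-- For a continuous pseudometric `d` on a Hausdorff space and a grey level map `ρ`, for
every `α ∈ [0,1]` the `α`-cuts of `ρ∘u` and `ρ∘v` are simultaneously empty or nonempty,
and if nonempty then `d_H([ρ∘u]^α,[ρ∘v]^α) ≤ d_{HF}(u,v)`. -/
theorem hausPD_grey_le_dHF {X : Type*} [TopologicalSpace X] [T2Space X]
    (d : X → X → ℝ) (hd : IsPseudometricFn d)
    (hdc : Continuous fun p : X × X => d p.1 p.2)
    (ρ : ℝ → ℝ) (hρ : IsGreyMap ρ) (u v : X → ℝ)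
    (hu : IsFuzzyCompact u) (hv : IsFuzzyCompact v) :
    ∀ α ∈ Set.Icc (0 : ℝ) 1,
      ((acut (fun x => ρ (u x)) α).Nonempty ↔ (acut (fun x => ρ (v x)) α).Nonempty) ∧
      ((acut (fun x => ρ (u x)) α).Nonempty →
        hausPD d (acut (fun x => ρ (u x)) α) (acut (fun x => ρ (v x)) α) ≤ dHF d u v) := by
  intro α hα
  have h1 := side_aux d hd hdc ρ hρ u v hu hv α hα
  have h2 := side_aux d hd hdc ρ hρ v u hv hu α hα
  rw [dHF_symm_aux d hd v u] at h2
  refine ⟨⟨?_, ?_⟩, fun _ => hausPD_le_aux d hd _ _ _ (dHF_nonneg_aux d hd u v) h1 h2⟩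
  · rintro ⟨x, hx⟩
    obtain ⟨y, hy, -⟩ := h1 x hx 1 one_pos
    exact ⟨y, hy⟩
  · rintro ⟨x, hx⟩
    obtain ⟨y, hy, -⟩ := h2 x hx 1 one_pos
    exact ⟨y, hy⟩
end

section
/- Let d be a continuous pseudometric on a Hausdorff topological space X, let f:X→X be continuous, let K and L be nonempty compact subsets of X, and let φ be a comparison function such that d(f(x),f(y)) ≤ φ(d(x,y)) for all x,y ∈ K ∪ L. Then d_H(f(K),f(L)) ≤ φ(d_H(K,L)). -/
open Filter Topology Set

theorem hausPD_aux {X : Type*} [TopologicalSpace X]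
    (e : X → X → ℝ) (he : ∀ x y, 0 ≤ e x y)
    (hec : Continuous fun p : X × X => e p.1 p.2)
    (f : X → X) (K L : Set X) (hKne : K.Nonempty) (hK : IsCompact K)
    (hLne : L.Nonempty) (hL : IsCompact L)
    (φ : ℝ → ℝ) (hφ : MonotoneOn φ (Set.Ici 0))
    (hcontr : ∀ x ∈ K, ∀ y ∈ L, e (f x) (f y) ≤ φ (e x y)) (H : ℝ)
    (hH : sSup ((fun x => sInf ((fun y => e x y) '' L)) '' K) ≤ H) :
    sSup ((fun x => sInf ((fun y => e x y) '' (f '' L))) '' (f '' K)) ≤ φ H := by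
  have hbb : ∀ (x : X) (S : Set X), BddBelow ((fun y => e x y) '' S) := by
    intro x S
    refine ⟨0, ?_⟩
    rintro _ ⟨y, _, rfl⟩
    exact he x y
  have hba : BddAbove ((fun x => sInf ((fun y => e x y) '' L)) '' K) := by
    obtain ⟨y0, hy0⟩ := hLne
    have hc : Continuous fun x => e x y0 :=
      hec.comp (Continuous.prodMk continuous_id continuous_const)
    obtain ⟨C, hC⟩ := hK.bddAbove_image hc.continuousOn
    refine ⟨C, ?_⟩
    rintro _ ⟨x, hx, rfl⟩
    exact (csInf_le (hbb x L) ⟨y0, hy0, rfl⟩).trans (hC ⟨x, hx, rfl⟩)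
  apply csSup_le ((hKne.image f).image _)
  rintro _ ⟨_, ⟨x, hx, rfl⟩, rfl⟩
  have hc : Continuous fun y => e x y :=
    hec.comp (Continuous.prodMk continuous_const continuous_id)
  obtain ⟨y, hy, hxy⟩ := hL.exists_sInf_image_eq hLne hc.continuousOn
  have h1 : e x y ≤ H := by
    rw [← hxy]
    exact (le_csSup hba ⟨x, hx, rfl⟩).trans hH
  calc sInf ((fun y => e (f x) y) '' (f '' L)) ≤ e (f x) (f y) :=
        csInf_le (hbb _ _) ⟨f y, ⟨y, hy, rfl⟩, rfl⟩
    _ ≤ φ (e x y) := hcontr x hx y hy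
    _ ≤ φ H := hφ (he x y) ((he x y).trans h1) h1

/-- If `d` is a continuous pseudometric, `K, L` are nonempty compact sets and `φ` is a
comparison function with `d(f x, f y) ≤ φ(d(x,y))` for `x, y ∈ K ∪ L`, then
`d_H(f(K), f(L)) ≤ φ(d_H(K,L))`. -/
theorem hausPD_image_le_comparison {X : Type*} [TopologicalSpace X] [T2Space X]
    (d : X → X → ℝ) (hd : IsPseudometricFn d)
    (hdc : Continuous fun p : X × X => d p.1 p.2)
    (f : X → X) (hf : Continuous f)
    (K L : Set X) (hKne : K.Nonempty) (hK : IsCompact K)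
    (hLne : L.Nonempty) (hL : IsCompact L)
    (φ : ℝ → ℝ) (hφ : IsComparisonFn φ)
    (hcontr : ∀ x ∈ K ∪ L, ∀ y ∈ K ∪ L, d (f x) (f y) ≤ φ (d x y)) :
    hausPD d (f '' K) (f '' L) ≤ φ (hausPD d K L) := by
  apply max_le
  · exact hausPD_aux d hd.1 hdc f K L hKne hK hLne hL φ hφ.2.1
      (fun x hx y hy => hcontr x (Or.inl hx) y (Or.inr hy)) _ (le_max_left _ _)
  · exact hausPD_aux (fun y x => d x y) (fun y x => hd.1 x y)
      (hdc.comp continuous_swap) f L K hLne hL hKne hK φ hφ.2.1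
      (fun y hy x hx => hcontr x (Or.inl hx) y (Or.inr hy)) _ (le_max_right _ _)
end
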